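/- Let p ∈ [0,1] and let K₀ = √((1+3p)/4)·I₂, K₁ = √((1−p)/4)·σx, K₂ = √((1−p)/4)·σy, K₃ = √((1−p)/4)·σz be the Kraus operators of the qubit depolarizing channel. Set ρ'' = Σᵢ₌₀³ Σⱼ₌₀³ (Kᵢ⊗Kⱼ)·ρ_AB·(Kᵢ⊗Kⱼ)†, the state with the depolarizing channel applied to both qubits. Then tr[ρ''·𝔅] = 4√3·p². -/

import Mathlib

open Matrix Kronecker
open scoped ComplexOrder

noncomputable def σx : Matrix (Fin 2) (Fin 2) ℂ := !![0, 1; 1, 0]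
noncomputable def σy : Matrix (Fin 2) (Fin 2) ℂ := !![0, -Complex.I; Complex.I, 0]
noncomputable def σz : Matrix (Fin 2) (Fin 2) ℂ := !![1, 0; 0, -1]

/-- Bob's observables for the Elegant Bell inequality. -/
noncomputable def B1 : Matrix (Fin 2) (Fin 2) ℂ := (Real.sqrt 3 : ℂ)⁻¹ • (σx - σy + σz)
noncomputable def B2 : Matrix (Fin 2) (Fin 2) ℂ := (Real.sqrt 3 : ℂ)⁻¹ • (σx + σy - σz)
noncomputable def B3 : Matrix (Fin 2) (Fin 2) ℂ := (Real.sqrt 3 : ℂ)⁻¹ • (-σx - σy - σz)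
noncomputable def B4 : Matrix (Fin 2) (Fin 2) ℂ := (Real.sqrt 3 : ℂ)⁻¹ • (-σx + σy + σz)

/-- The EBI Bell operator 𝔅 with Alice's observables A₁ = σx, A₂ = σy, A₃ = σz. -/
noncomputable def EBIop : Matrix (Fin 2 × Fin 2) (Fin 2 × Fin 2) ℂ :=
  σx ⊗ₖ (B1 + B2 - B3 - B4) + σy ⊗ₖ (B1 - B2 + B3 - B4) + σz ⊗ₖ (B1 - B2 - B3 + B4)

/-- The maximally entangled two-qubit state. -/
noncomputable def ρAB : Matrix (Fin 2 × Fin 2) (Fin 2 × Fin 2) ℂ :=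
  (4 : ℂ)⁻¹ • ((1 : Matrix (Fin 2) (Fin 2) ℂ) ⊗ₖ (1 : Matrix (Fin 2) (Fin 2) ℂ)
    + σx ⊗ₖ σx - σy ⊗ₖ σy + σz ⊗ₖ σz)

/-- Kraus operators of the qubit depolarizing channel with parameter `p`. -/
noncomputable def depolK (p : ℝ) : Fin 4 → Matrix (Fin 2) (Fin 2) ℂ :=
  ![(Real.sqrt ((1 + 3 * p) / 4) : ℂ) • (1 : Matrix (Fin 2) (Fin 2) ℂ),
    (Real.sqrt ((1 - p) / 4) : ℂ) • σx,
    (Real.sqrt ((1 - p) / 4) : ℂ) • σy,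
    (Real.sqrt ((1 - p) / 4) : ℂ) • σz]

/-- The channel with Kraus operators `K`. -/
noncomputable def krausMap {ι n : Type*} [Fintype ι] [Fintype n] (K : ι → Matrix n n ℂ)
    (A : Matrix n n ℂ) : Matrix n n ℂ :=
  ∑ i, K i * A * (K i)ᴴ

/-- Local channels act factorwise on product operators. -/
theorem sum_kronecker_conj {ι n : Type*} [Fintype ι] [Fintype n]
    (K : ι → Matrix n n ℂ) (A B : Matrix n n ℂ) :
    ∑ i, ∑ j, (K i ⊗ₖ K j) * (A ⊗ₖ B) * (K i ⊗ₖ K j)ᴴ = krausMap K A ⊗ₖ krausMap K B := by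
  simp only [krausMap, conjTranspose_kronecker, ← mul_kronecker_mul]
  ext ⟨a, b⟩ ⟨c, d⟩
  simp only [Matrix.sum_apply, kronecker_apply, Finset.sum_mul_sum]

theorem ofReal_sqrt_mul_self {x : ℝ} (hx : 0 ≤ x) :
    (Real.sqrt x : ℂ) * (Real.sqrt x : ℂ) = (x : ℂ) := by
  rw [← Complex.ofReal_mul, Real.mul_self_sqrt hx]

theorem conjTranspose_σx : σxᴴ = σx := by
  ext i j; fin_cases i <;> fin_cases j <;> simp [σx]

theorem conjTranspose_σy : σyᴴ = σy := by
  ext i j; fin_cases i <;> fin_cases j <;> simp [σy]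

theorem conjTranspose_σz : σzᴴ = σz := by
  ext i j; fin_cases i <;> fin_cases j <;> simp [σz]

theorem krausMap_depolK {p : ℝ} (hp0 : 0 ≤ p) (hp1 : p ≤ 1) (A : Matrix (Fin 2) (Fin 2) ℂ) :
    krausMap (depolK p) A = (((1 + 3 * p) / 4 : ℝ) : ℂ) • A
      + (((1 - p) / 4 : ℝ) : ℂ) • (σx * A * σx + σy * A * σy + σz * A * σz) := by
  have h0 : 0 ≤ (1 + 3 * p) / 4 := by linarith
  have h1 : 0 ≤ (1 - p) / 4 := by linarith
  rw [← ofReal_sqrt_mul_self h0, ← ofReal_sqrt_mul_self h1]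
  simp [krausMap, Fin.sum_univ_four, depolK, conjTranspose_smul, conjTranspose_σx,
    conjTranspose_σy, conjTranspose_σz, smul_smul, add_assoc]

theorem pauli_twirl (A : Matrix (Fin 2) (Fin 2) ℂ) :
    σx * A * σx + σy * A * σy + σz * A * σz = (2 * A.trace) • 1 - A := by
  rw [eta_fin_two A]
  ext i j
  fin_cases i <;> fin_cases j <;>
    simp [σx, σy, σz, trace_fin_two, mul_right_comm Complex.I] <;> ring

/-- The depolarizing channel replaces a qubit state by white noise with probability `1 - p`. -/
theorem krausMap_depolK_eq {p : ℝ} (hp0 : 0 ≤ p) (hp1 : p ≤ 1) (A : Matrix (Fin 2) (Fin 2) ℂ) :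
    krausMap (depolK p) A = (p : ℂ) • A + ((1 - p) / 2 * A.trace) • 1 := by
  rw [krausMap_depolK hp0 hp1, pauli_twirl]
  push_cast
  module

theorem krausMap_depolK_one {p : ℝ} (hp0 : 0 ≤ p) (hp1 : p ≤ 1) :
    krausMap (depolK p) 1 = 1 := by
  rw [krausMap_depolK_eq hp0 hp1, ← add_smul]
  simp

theorem krausMap_depolK_of_trace_eq_zero {p : ℝ} (hp0 : 0 ≤ p) (hp1 : p ≤ 1)
    {A : Matrix (Fin 2) (Fin 2) ℂ} (hA : A.trace = 0) :
    krausMap (depolK p) A = (p : ℂ) • A := by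
  simp [krausMap_depolK_eq hp0 hp1, hA]

theorem trace_σx : σx.trace = 0 := by simp [σx, trace_fin_two]
theorem trace_σy : σy.trace = 0 := by simp [σy, trace_fin_two]
theorem trace_σz : σz.trace = 0 := by simp [σz, trace_fin_two]

theorem EBIop_eq : EBIop = (4 * (Real.sqrt 3 : ℂ)⁻¹) • (σx ⊗ₖ σx - σy ⊗ₖ σy + σz ⊗ₖ σz) := by
  have hx : B1 + B2 - B3 - B4 = (4 * (Real.sqrt 3 : ℂ)⁻¹) • σx := by
    simp only [B1, B2, B3, B4]; module
  have hy : B1 - B2 + B3 - B4 = -((4 * (Real.sqrt 3 : ℂ)⁻¹) • σy) := by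
    simp only [B1, B2, B3, B4]; module
  have hz : B1 - B2 - B3 + B4 = (4 * (Real.sqrt 3 : ℂ)⁻¹) • σz := by
    simp only [B1, B2, B3, B4]; module
  rw [EBIop, hx, hy, hz, ← neg_smul]
  simp only [kronecker_smul]
  module

/-- The depolarized maximally entangled state has its correlations damped by `p ^ 2`. -/
theorem sum_depolK_conj_ρAB {p : ℝ} (hp0 : 0 ≤ p) (hp1 : p ≤ 1) :
    ∑ i, ∑ j, (depolK p i ⊗ₖ depolK p j) * ρAB * (depolK p i ⊗ₖ depolK p j)ᴴ
      = (4 : ℂ)⁻¹ • ((1 : Matrix (Fin 2) (Fin 2) ℂ) ⊗ₖ (1 : Matrix (Fin 2) (Fin 2) ℂ)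
        + ((p : ℂ) ^ 2) • (σx ⊗ₖ σx - σy ⊗ₖ σy + σz ⊗ₖ σz)) := by
  simp only [ρAB, Matrix.mul_smul, Matrix.smul_mul, mul_add, mul_sub, add_mul, sub_mul,
    ← Finset.smul_sum, Finset.sum_add_distrib, Finset.sum_sub_distrib, sum_kronecker_conj,
    krausMap_depolK_one hp0 hp1, krausMap_depolK_of_trace_eq_zero hp0 hp1 trace_σx,
    krausMap_depolK_of_trace_eq_zero hp0 hp1 trace_σy,
    krausMap_depolK_of_trace_eq_zero hp0 hp1 trace_σz, kronecker_smul, smul_kronecker]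
  module

theorem trace_pauli_correlation :
    (σx ⊗ₖ σx - σy ⊗ₖ σy + σz ⊗ₖ σz).trace = 0 := by
  simp [trace_add, trace_sub, trace_kronecker, trace_σx, trace_σy, trace_σz]

theorem trace_pauli_correlation_mul_self :
    ((σx ⊗ₖ σx - σy ⊗ₖ σy + σz ⊗ₖ σz) * (σx ⊗ₖ σx - σy ⊗ₖ σy + σz ⊗ₖ σz)).trace = 12 := by
  simp only [mul_add, mul_sub, add_mul, sub_mul, ← mul_kronecker_mul, trace_add, trace_sub,
    trace_kronecker]
  simp [σx, σy, σz, trace_fin_two]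
  norm_num

/-- Applying the depolarizing channel to both qubits of the maximally entangled
state gives EBI value `4√3·p²`. -/
theorem depol_both_qubits_EBI_value (p : ℝ) (hp0 : 0 ≤ p) (hp1 : p ≤ 1) :
    ((∑ i : Fin 4, ∑ j : Fin 4, (depolK p i ⊗ₖ depolK p j) * ρAB
        * (depolK p i ⊗ₖ depolK p j)ᴴ) * EBIop).trace
      = ((4 * Real.sqrt 3 * p ^ 2 : ℝ) : ℂ) := by
  rw [sum_depolK_conj_ρAB hp0 hp1, EBIop_eq]
  have h3 : (Real.sqrt 3 : ℂ) * Real.sqrt 3 = 3 := by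
    simpa using ofReal_sqrt_mul_self (show (0 : ℝ) ≤ 3 by norm_num)
  have hne : (Real.sqrt 3 : ℂ) ≠ 0 := left_ne_zero_of_mul (h3.trans_ne (by norm_num))
  rw [one_kronecker_one, Matrix.mul_smul, Matrix.smul_mul, Matrix.add_mul (1 : Matrix _ _ ℂ),
    Matrix.one_mul, Matrix.smul_mul]
  simp only [trace_smul, trace_add (_ - _ + _) (_ • _), trace_pauli_correlation, trace_pauli_correlation_mul_self, smul_eq_mul]
  push_cast
  field_simp
  linear_combination (-4 * (p : ℂ) ^ 2) * h3
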